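/- arXiv:1904.09878 — 2 statements merged into one kernel-verified Lean document; each statement's English description precedes it below -/
import Mathlib

section
/- For any finite set I and any composition P of I (an ordered list of nonempty pairwise disjoint sets whose union is I), the sum over all compositions Q of I refining P of (-1)^{l(Q)}, where l(Q) is the number of parts of Q, equals (-1)^{|I|}. -/
/-- `P` is a composition of the finite set `I`: a list of nonempty pairwise disjoint
finsets whose union is `I`. -/
def IsComp {α : Type*} [DecidableEq α] (I : Finset α) (P : List (Finset α)) : Prop :=
  (∀ p ∈ P, p.Nonempty) ∧ P.Pairwise Disjoint ∧ P.foldr (· ∪ ·) ∅ = I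

/-- `Q` refines `P`: `Q` is the concatenation of compositions of the parts of `P`, in order. -/
def Refines {α : Type*} [DecidableEq α] (Q P : List (Finset α)) : Prop :=
  ∃ Qs : List (List (Finset α)), List.Forall₂ (fun qs p => IsComp p qs) Qs P ∧ Q = Qs.flatten

theorem disjoint_foldr_union {α : Type*} [DecidableEq α] (S : Finset α) (Q : List (Finset α)) :
    Disjoint S (Q.foldr (· ∪ ·) ∅) ↔ ∀ q ∈ Q, Disjoint S q := by
  induction Q with
  | nil => simp
  | cons a Q ih => simp [ih]

theorem isComp_nil_iff {α : Type*} [DecidableEq α] {I : Finset α} : IsComp I [] ↔ I = ∅ := by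
  simp [IsComp, eq_comm]

theorem isComp_cons_iff {α : Type*} [DecidableEq α] {I S : Finset α} {Q : List (Finset α)} :
    IsComp I (S :: Q) ↔ S.Nonempty ∧ S ⊆ I ∧ IsComp (I \ S) Q := by
  simp only [IsComp, List.forall_mem_cons, List.pairwise_cons, List.foldr_cons,
    ← disjoint_foldr_union]
  constructor
  · rintro ⟨⟨hS, hne⟩, ⟨hd, hp⟩, rfl⟩
    exact ⟨hS, Finset.subset_union_left, hne, hp,
      (Finset.union_sdiff_cancel_left hd).symm⟩
  · rintro ⟨hS, hSI, hne, hp, hU⟩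
    rw [hU]
    exact ⟨⟨hS, hne⟩, ⟨Finset.disjoint_sdiff, hp⟩, Finset.union_sdiff_of_subset hSI⟩

theorem IsComp.card_eq_sum {α : Type*} [DecidableEq α] {I : Finset α} {P : List (Finset α)}
    (hP : IsComp I P) : I.card = (P.map Finset.card).sum := by
  induction P generalizing I with
  | nil => simp [isComp_nil_iff.1 hP]
  | cons S P ih =>
    obtain ⟨-, hSI, hP⟩ := isComp_cons_iff.1 hP
    rw [List.map_cons, List.sum_cons, ← ih hP, add_comm, Finset.card_sdiff_add_card_eq_card hSI]

theorem refines_nil_iff {α : Type*} [DecidableEq α] {Q : List (Finset α)} :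
    Refines Q [] ↔ Q = [] := by
  simp [Refines]

theorem refines_cons_iff {α : Type*} [DecidableEq α] {p : Finset α} {Q P : List (Finset α)} :
    Refines Q (p :: P) ↔ ∃ q r, IsComp p q ∧ Refines r P ∧ Q = q ++ r := by
  simp only [Refines, List.forall₂_cons_right_iff]
  constructor
  · rintro ⟨_, ⟨q, Qs, hq, hQs, rfl⟩, rfl⟩
    exact ⟨q, _, hq, ⟨Qs, hQs, rfl⟩, rfl⟩
  · rintro ⟨q, _, hq, ⟨Qs, hQs, rfl⟩, rfl⟩
    exact ⟨q :: Qs, ⟨q, Qs, hq, hQs, rfl⟩, rfl⟩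

theorem refines_empty_cons_iff {α : Type*} [DecidableEq α] {Q P : List (Finset α)} :
    Refines Q (∅ :: P) ↔ Refines Q P := by
  rw [refines_cons_iff]
  constructor
  · rintro ⟨_ | ⟨S, q⟩, r, hq, hr, rfl⟩
    · exact hr
    · obtain ⟨hS, hSI, -⟩ := isComp_cons_iff.1 hq
      exact absurd (Finset.subset_empty.1 hSI) hS.ne_empty
  · exact fun h => ⟨[], Q, isComp_nil_iff.2 rfl, h, rfl⟩

theorem refines_cons_iff_of_nonempty {α : Type*} [DecidableEq α] {p : Finset α}
    (hp : p.Nonempty) {Q P : List (Finset α)} :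
    Refines Q (p :: P) ↔
      ∃ S ∈ p.powerset.erase ∅, ∃ R, Refines R ((p \ S) :: P) ∧ S :: R = Q := by
  simp only [refines_cons_iff, Finset.mem_erase, Finset.mem_powerset,
    ← Finset.nonempty_iff_ne_empty]
  constructor
  · rintro ⟨_ | ⟨S, q⟩, r, hq, hr, rfl⟩
    · exact absurd (isComp_nil_iff.1 hq) hp.ne_empty
    · obtain ⟨hS, hSI, hq⟩ := isComp_cons_iff.1 hq
      exact ⟨S, ⟨hS, hSI⟩, q ++ r, ⟨q, r, hq, hr, rfl⟩, rfl⟩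
  · rintro ⟨S, ⟨hS, hSI⟩, _, ⟨q, r, hq, hr, rfl⟩, rfl⟩
    exact ⟨S :: q, r, isComp_cons_iff.2 ⟨hS, hSI, hq⟩, hr, rfl⟩

theorem sum_erase_empty_powerset_neg_one_pow_card_sdiff {α : Type*} [DecidableEq α]
    {p : Finset α} (hp : p.Nonempty) :
    ∑ S ∈ p.powerset.erase ∅, (-1 : ℤ) ^ (p \ S).card = -(-1) ^ p.card := by
  have h : ∑ S ∈ p.powerset, (-1 : ℤ) ^ (p \ S).card = 0 := by
    rw [← Finset.sum_powerset_neg_one_pow_card_of_nonempty hp]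
    refine Finset.sum_nbij' (p \ ·) (p \ ·) ?_ ?_ ?_ ?_ ?_ <;> simp +contextual
  have h' := Finset.add_sum_erase p.powerset (fun S => (-1 : ℤ) ^ (p \ S).card)
    (Finset.empty_mem_powerset p)
  rw [h, Finset.sdiff_empty] at h'
  linarith

/-- Every list of finsets has finitely many refinements, with signed count
`(-1) ^ ∑ |p|`; neither nonemptiness nor disjointness of the parts is needed. -/
theorem exists_finset_refines {α : Type*} [DecidableEq α] (P : List (Finset α)) :
    ∃ F : Finset (List (Finset α)), (∀ Q, Q ∈ F ↔ Refines Q P) ∧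
      ∑ Q ∈ F, (-1 : ℤ) ^ Q.length = (-1) ^ (P.map Finset.card).sum := by
  induction P with
  | nil => exact ⟨{[]}, by simp [refines_nil_iff]⟩
  | cons p P ih =>
    induction p using Finset.strongInduction with
    | H p ihp =>
      obtain rfl | hp := p.eq_empty_or_nonempty
      · simpa [refines_empty_cons_iff] using ih
      have key : ∀ S ∈ p.powerset.erase ∅, ∃ F : Finset (List (Finset α)),
          (∀ Q, Q ∈ F ↔ Refines Q ((p \ S) :: P)) ∧ ∑ Q ∈ F, (-1 : ℤ) ^ Q.length =
            (-1) ^ (((p \ S) :: P).map Finset.card).sum := by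
        intro S hS
        rw [Finset.mem_erase, Finset.mem_powerset] at hS
        exact ihp _ (Finset.sdiff_ssubset hS.2 (Finset.nonempty_iff_ne_empty.2 hS.1))
      choose! F hF hsum using key
      refine ⟨(p.powerset.erase ∅).biUnion fun S => (F S).image (List.cons S), ?_, ?_⟩
      · intro Q
        rw [refines_cons_iff_of_nonempty hp, Finset.mem_biUnion]
        refine exists_congr fun S => and_congr_right fun hS => ?_
        simp only [Finset.mem_image, hF S hS]
      · rw [Finset.sum_biUnion]
        · calc
            _ = ∑ S ∈ p.powerset.erase ∅,
                -((-1 : ℤ) ^ (p \ S).card * (-1) ^ (P.map Finset.card).sum) := by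
              refine Finset.sum_congr rfl fun S hS => ?_
              rw [Finset.sum_image (List.cons_injective.injOn), ← pow_add]
              simpa [pow_succ] using hsum S hS
            _ = _ := by
              rw [Finset.sum_neg_distrib, ← Finset.sum_mul,
                sum_erase_empty_powerset_neg_one_pow_card_sdiff hp]
              simp [pow_add]
        · intro S _ T _ hST
          rw [Function.onFun, Finset.disjoint_left]
          intro Q hQ hQ'
          simp only [Finset.mem_image] at hQ hQ'
          obtain ⟨R, -, rfl⟩ := hQ
          obtain ⟨R', -, h⟩ := hQ'
          exact hST (List.cons.inj h).1.symm

/-- For any composition `P` of `I`, `∑_{Q ≺ P} (-1)^{l(Q)} = (-1)^{|I|}`. -/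
theorem stmt_2 {α : Type*} [DecidableEq α] (I : Finset α) (P : List (Finset α))
    (hP : IsComp I P) :
    ∑ᶠ (Q : List (Finset α)) (_ : Refines Q P), ((-1 : ℤ) ^ Q.length) = (-1) ^ I.card := by
  obtain ⟨F, hF, hsum⟩ := exists_finset_refines P
  simp only [← hF]
  rw [finsum_mem_finset_eq_sum, hsum, hP.card_eq_sum]
end

section
/- For a finite simple graph g, the number of compatible pairs (acyclic orientation of g, coloring of the vertices with 1 color) equals the number of acyclic orientations of g; consequently, denoting by \chi the chromatic polynomial of g on vertex set I, (-1)^{|I|} \chi(-1) equals the number of acyclic orientations of g. (Stanley's reciprocity for n = 1.) -/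
variable {α : Type*} [DecidableEq α]

/-- The nonempty edges of the hypergraph `H`. -/
abbrev Edge (H : Finset (Finset α)) := {e : Finset α // e ∈ H ∧ e.Nonempty}

/-- An orientation assigns to each (nonempty) edge one of its vertices. -/
def IsOrientation {H : Finset (Finset α)} (f : Edge H → α) : Prop :=
  ∀ e : Edge H, f e ∈ e.1

/-- A directed cycle: a nonempty list of distinct edges `e₁, …, e_k` with
`f(eᵢ) ∈ e_{i+1} \ {f(e_{i+1})}`, indices mod `k`. -/
def HasCycle {H : Finset (Finset α)} (f : Edge H → α) : Prop :=
  ∃ l : List (Edge H), l ≠ [] ∧ l.Nodup ∧ ∀ i : Fin l.length,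
    f (l.get i) ∈ (l.get ⟨(i.1 + 1) % l.length, Nat.mod_lt _ i.pos⟩).1.1 ∧
    f (l.get i) ≠ f (l.get ⟨(i.1 + 1) % l.length, Nat.mod_lt _ i.pos⟩)

/-- `S` is compatible with `f`: each edge's head has maximal color in the edge. -/
def Compat {H : Finset (Finset α)} {n : ℕ} (f : Edge H → α) (S : α → Fin n) : Prop :=
  ∀ e : Edge H, ∀ v ∈ e.1, S v ≤ S (f e)

/-- `S` is strictly compatible with `f`: each edge's head is the unique vertex of
maximal color in the edge. -/
def StrictCompat {H : Finset (Finset α)} {n : ℕ} (f : Edge H → α) (S : α → Fin n) : Prop :=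
  ∀ e : Edge H, ∀ v ∈ e.1, v ≠ f e → S v < S (f e)

/-- Every nonempty edge of `H` has a unique maximal vertex for the coloring `S`. -/
def UniqMax {n : ℕ} (H : Finset (Finset α)) (S : α → Fin n) : Prop :=
  ∀ e ∈ H, e.Nonempty → ∃! v, v ∈ e ∧ ∀ w ∈ e, S w ≤ S v

/-- A proper coloring of a graph: no edge is monochromatic. -/
def Proper {n : ℕ} (H : Finset (Finset α)) (S : α → Fin n) : Prop :=
  ∀ e ∈ H, ∀ u ∈ e, ∀ v ∈ e, u ≠ v → S u ≠ S v

/-- Every polynomial over `ℚ` has an antidifference vanishing at `0`. -/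
theorem Polynomial.exists_antidifference (p : Polynomial ℚ) :
    ∃ q : Polynomial ℚ, q.eval 0 = 0 ∧ ∀ x, q.eval (x + 1) - q.eval x = p.eval x := by
  induction p using Polynomial.induction_on' with
  | add p₁ p₂ h₁ h₂ =>
    obtain ⟨q₁, h₁, h₁'⟩ := h₁
    obtain ⟨q₂, h₂, h₂'⟩ := h₂
    refine ⟨q₁ + q₂, by simp [h₁, h₂], fun x ↦ ?_⟩
    rw [Polynomial.eval_add, Polynomial.eval_add, Polynomial.eval_add, ← h₁', ← h₂']
    ring
  | monomial n a =>
    set B := Polynomial.bernoulli (n + 1)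
    refine ⟨Polynomial.C (a / (n + 1)) * (B - Polynomial.C (B.eval 0)), by simp, fun x ↦ ?_⟩
    have h : B.eval (x + 1) = B.eval x + (n + 1) * x ^ n := by
      rw [add_comm x 1, Polynomial.bernoulli_eval_one_add]
      simp [B]
    have hn : (n + 1 : ℚ) ≠ 0 := by positivity
    simp only [Polynomial.eval_mul, Polynomial.eval_C, Polynomial.eval_sub, h,
      Polynomial.eval_monomial]
    field_simp
    ring

/-- The set `T` is independent for the relation `adj`. -/
def IsIndep (adj : α → α → Prop) (T : Finset α) : Prop :=
  ∀ u ∈ T, ∀ v ∈ T, ¬ adj u v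

open Classical in
/-- The independent subsets of `W`. -/
noncomputable def indepSets (adj : α → α → Prop) (W : Finset α) : Finset (Finset α) :=
  {T ∈ W.powerset | IsIndep adj T}

theorem mem_indepSets {V : Type*} {adj : V → V → Prop} {W T : Finset V} :
    T ∈ indepSets adj W ↔ T ⊆ W ∧ IsIndep adj T := by
  simp [indepSets]

theorem empty_mem_indepSets {V : Type*} (adj : V → V → Prop) (W : Finset V) :
    ∅ ∈ indepSets adj W := by
  simp [mem_indepSets, IsIndep]

open Classical in
/-- The proper colorings of the subgraph induced on `W` with colors `1, …, m`, extended by `0`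
outside of `W`. -/
noncomputable def inducedColorings [Fintype α] (adj : α → α → Prop) (W : Finset α) (m : ℕ) :
    Finset (α → ℕ) :=
  {k ∈ (Fintype.piFinset fun v ↦ if v ∈ W then Finset.Icc 1 m else {0} : Finset (α → ℕ)) |
    ∀ u ∈ W, ∀ v ∈ W, adj u v → k u ≠ k v}

theorem mem_inducedColorings [Fintype α] {adj : α → α → Prop} {W : Finset α} {m : ℕ}
    {k : α → ℕ} :
    k ∈ inducedColorings adj W m ↔ (∀ v ∈ W, 1 ≤ k v ∧ k v ≤ m) ∧ (∀ v ∉ W, k v = 0) ∧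
      ∀ u ∈ W, ∀ v ∈ W, adj u v → k u ≠ k v := by
  simp only [inducedColorings, Finset.mem_filter, Fintype.mem_piFinset]
  rw [← and_assoc]
  refine and_congr_left' ⟨fun h ↦ ⟨fun v hv ↦ ?_, fun v hv ↦ ?_⟩, fun h v ↦ ?_⟩
  · simpa [hv] using h v
  · simpa [hv] using h v
  · by_cases hv : v ∈ W
    · simpa [hv] using h.1 v hv
    · simpa [hv] using h.2 v hv

/-- Splitting off the color class of the largest color. -/
theorem card_inducedColorings_succ [Fintype α] (adj : α → α → Prop) (W : Finset α) (m : ℕ) :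
    (inducedColorings adj W (m + 1)).card =
      ∑ T ∈ indepSets adj W, (inducedColorings adj (W \ T) m).card := by
  classical
  rw [Finset.card_eq_sum_card_fiberwise
    (f := fun k : α → ℕ ↦ ({v | k v = m + 1} : Finset α)) (t := indepSets adj W)]
  · refine Finset.sum_congr rfl fun T hT ↦ ?_
    obtain ⟨hTW, hT⟩ := mem_indepSets.1 hT
    refine Finset.card_nbij' (fun k v ↦ if v ∈ T then 0 else k v)
      (fun k v ↦ if v ∈ T then m + 1 else k v) ?_ ?_ ?_ ?_
    · intro k hk
      simp only [Finset.coe_filter, Set.mem_ofPred_eq, mem_inducedColorings, Finset.ext_iff,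
        Finset.mem_filter, Finset.mem_univ, true_and] at hk
      simp only [Finset.mem_coe, mem_inducedColorings, Finset.mem_sdiff]
      grind
    · intro k hk
      simp only [Finset.mem_coe, mem_inducedColorings, Finset.mem_sdiff] at hk
      simp only [Finset.coe_filter, Set.mem_ofPred_eq, mem_inducedColorings, Finset.ext_iff,
        Finset.mem_filter, Finset.mem_univ, true_and]
      unfold IsIndep at hT
      grind
    · intro k hk
      simp only [Finset.coe_filter, Set.mem_ofPred_eq, Finset.ext_iff,
        Finset.mem_filter, Finset.mem_univ, true_and] at hk
      funext v
      grind
    · intro k hk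
      simp only [Finset.mem_coe, mem_inducedColorings, Finset.mem_sdiff] at hk
      funext v
      grind
  · intro k hk
    simp only [Finset.mem_coe, mem_inducedColorings] at hk
    simp only [Finset.mem_coe, mem_indepSets, IsIndep, Finset.subset_iff, Finset.mem_filter,
      Finset.mem_univ, true_and]
    have hmem {v : α} (hv : k v = m + 1) : v ∈ W := by grind
    exact ⟨fun _ ↦ hmem, fun u hu v hv huv ↦
      hk.2.2 u (hmem hu) v (hmem hv) huv (hu.trans hv.symm)⟩

/-- `r` is an acyclic orientation of the subgraph induced on `W`, with `r u v` meaning that the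
edge `uv` points to `v`. -/
structure IsAcyclicOrientation (adj : α → α → Prop) (W : Finset α) (r : α → α → Prop) :
    Prop where
  left_mem : ∀ {u v : α}, r u v → u ∈ W
  right_mem : ∀ {u v : α}, r u v → v ∈ W
  adj_of : ∀ {u v : α}, r u v → adj u v
  total : ∀ {u v : α}, u ∈ W → v ∈ W → adj u v → r u v ∨ r v u
  acyclic : ∀ x : α, ¬ Relation.TransGen r x x

open Classical in
/-- The acyclic orientations of the subgraph induced on `W`. -/
noncomputable def acyclicOrientations [Fintype α] (adj : α → α → Prop) (W : Finset α) :
    Finset (α → α → Prop) :=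
  {r | IsAcyclicOrientation adj W r}

theorem mem_acyclicOrientations [Fintype α] {adj : α → α → Prop} {W : Finset α}
    {r : α → α → Prop} : r ∈ acyclicOrientations adj W ↔ IsAcyclicOrientation adj W r := by
  simp [acyclicOrientations]

open Classical in
/-- The vertices of `W` without outgoing edge. -/
noncomputable def sinks (W : Finset α) (r : α → α → Prop) : Finset α :=
  {v ∈ W | ∀ u, ¬ r v u}

theorem mem_sinks {V : Type*} {W : Finset V} {r : V → V → Prop} {v : V} :
    v ∈ sinks W r ↔ v ∈ W ∧ ∀ u, ¬ r v u := by
  simp [sinks]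

theorem IsAcyclicOrientation.sinks_nonempty {V : Type*} [Finite V]
    {adj : V → V → Prop} {W : Finset V}
    {r : V → V → Prop} (h : IsAcyclicOrientation adj W r) (hW : W.Nonempty) :
    (sinks W r).Nonempty := by
  let s : V → V → Prop := fun a b ↦ Relation.TransGen r b a
  have : IsTrans V s := ⟨fun _ _ _ hab hbc ↦ hbc.trans hab⟩
  have : Std.Irrefl s := ⟨h.acyclic⟩
  obtain ⟨v, hv, hmin⟩ := (Finite.wellFounded_of_trans_of_irrefl s).has_min (W : Set V) hW
  exact ⟨v, mem_sinks.2 ⟨hv, fun u hu ↦ hmin u (h.right_mem hu) (.single hu)⟩⟩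

theorem IsAcyclicOrientation.isIndep_of_subset_sinks {V : Type*}
    {adj : V → V → Prop} {W T : Finset V}
    {r : V → V → Prop} (h : IsAcyclicOrientation adj W r) (hT : T ⊆ sinks W r) :
    IsIndep adj T := by
  intro u hu v hv huv
  have hu := mem_sinks.1 (hT hu)
  have hv := mem_sinks.1 (hT hv)
  rcases h.total hu.1 hv.1 huv with h | h
  · exact hu.2 _ h
  · exact hv.2 _ h

/-- Deleting a set of vertices. -/
theorem IsAcyclicOrientation.sdiff {adj : α → α → Prop} {W : Finset α}
    {r : α → α → Prop} (h : IsAcyclicOrientation adj W r) (T : Finset α) :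
    IsAcyclicOrientation adj (W \ T) fun u v ↦ r u v ∧ u ∉ T ∧ v ∉ T where
  left_mem h' := Finset.mem_sdiff.2 ⟨h.left_mem h'.1, h'.2.1⟩
  right_mem h' := Finset.mem_sdiff.2 ⟨h.right_mem h'.1, h'.2.2⟩
  adj_of h' := h.adj_of h'.1
  total hu hv huv := by
    rw [Finset.mem_sdiff] at hu hv
    rcases h.total hu.1 hv.1 huv with h | h
    · exact .inl ⟨h, hu.2, hv.2⟩
    · exact .inr ⟨h, hv.2, hu.2⟩
  acyclic x hx := h.acyclic x (Relation.TransGen.mono (fun _ _ h' ↦ h'.1) _ _ hx)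

/-- Adding an independent set of sinks. -/
theorem IsAcyclicOrientation.extend {adj : α → α → Prop} (hadj : ∀ u v, adj u v → adj v u)
    {W T : Finset α} (hTW : T ⊆ W) (hT : IsIndep adj T) {r : α → α → Prop}
    (h : IsAcyclicOrientation adj (W \ T) r) :
    IsAcyclicOrientation adj W fun u v ↦ r u v ∨ (u ∈ W ∧ v ∈ T ∧ adj u v) where
  left_mem h' := h'.elim (fun h' ↦ (Finset.mem_sdiff.1 (h.left_mem h')).1) fun h' ↦ h'.1
  right_mem h' := h'.elim (fun h' ↦ (Finset.mem_sdiff.1 (h.right_mem h')).1) fun h' ↦ hTW h'.2.1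
  adj_of h' := h'.elim h.adj_of fun h' ↦ h'.2.2
  total {u v} hu hv huv := by
    by_cases hu' : u ∈ T
    · exact .inr (.inr ⟨hv, hu', hadj _ _ huv⟩)
    by_cases hv' : v ∈ T
    · exact .inl (.inr ⟨hu, hv', huv⟩)
    exact (h.total (Finset.mem_sdiff.2 ⟨hu, hu'⟩) (Finset.mem_sdiff.2 ⟨hv, hv'⟩) huv).imp
      .inl .inl
  acyclic x hx := by
    have not_mem {a b : α} (hab : r a b ∨ (a ∈ W ∧ b ∈ T ∧ adj a b)) : a ∉ T := by
      rcases hab with hab | ⟨-, hb, hab⟩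
      · exact (Finset.mem_sdiff.1 (h.left_mem hab)).2
      · exact fun ha ↦ hT a ha b hb hab
    have lift {a b : α}
        (hab : Relation.TransGen (fun u v ↦ r u v ∨ (u ∈ W ∧ v ∈ T ∧ adj u v)) a b) :
        b ∉ T → Relation.TransGen r a b := by
      induction hab with
      | single hab => exact fun hb ↦ .single (hab.resolve_right fun h' ↦ hb h'.2.1)
      | tail _ hbc ih =>
        exact fun hc ↦ .tail (ih (not_mem hbc)) (hbc.resolve_right fun h' ↦ hc h'.2.1)
    obtain ⟨y, hy, -⟩ := Relation.TransGen.head'_iff.1 hx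
    exact h.acyclic x (lift hx (not_mem hy))

theorem card_acyclicOrientations_sinks [Fintype α] {adj : α → α → Prop}
    (hadj : ∀ u v, adj u v → adj v u) {W T : Finset α} (hTW : T ⊆ W) (hT : IsIndep adj T) :
    {r ∈ acyclicOrientations adj W | T ⊆ sinks W r}.card =
      (acyclicOrientations adj (W \ T)).card := by
  refine Finset.card_nbij' (fun r u v ↦ r u v ∧ u ∉ T ∧ v ∉ T)
    (fun r u v ↦ r u v ∨ (u ∈ W ∧ v ∈ T ∧ adj u v)) ?_ ?_ ?_ ?_
  · intro r hr
    simp only [Finset.coe_filter, Set.mem_ofPred_eq, mem_acyclicOrientations] at hr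
    exact mem_acyclicOrientations.2 (hr.1.sdiff T)
  · intro r hr
    have hr := mem_acyclicOrientations.1 hr
    simp only [Finset.coe_filter, Set.mem_ofPred_eq, mem_acyclicOrientations]
    refine ⟨hr.extend hadj hTW hT, fun v hv ↦ mem_sinks.2 ⟨hTW hv, fun u hu ↦ ?_⟩⟩
    rcases hu with hu | hu
    · exact (Finset.mem_sdiff.1 (hr.left_mem hu)).2 hv
    · exact hT v hv u hu.2.1 hu.2.2
  · intro r hr
    simp only [Finset.coe_filter, Set.mem_ofPred_eq, mem_acyclicOrientations] at hr
    obtain ⟨hr, hs⟩ := hr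
    funext u v
    refine propext ⟨?_, fun h ↦ ?_⟩
    · rintro (h | ⟨hu, hv, huv⟩)
      · exact h.1
      · exact (hr.total hu (hTW hv) huv).resolve_right ((mem_sinks.1 (hs hv)).2 u)
    · by_cases hv : v ∈ T
      · exact .inr ⟨hr.left_mem h, hv, hr.adj_of h⟩
      · exact .inl ⟨h, fun hu ↦ (mem_sinks.1 (hs hu)).2 v h, hv⟩
  · intro r hr
    have hr := mem_acyclicOrientations.1 hr
    funext u v
    refine propext ⟨?_, fun h ↦ ?_⟩
    · rintro ⟨h | h, hu, hv⟩
      · exact h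
      · exact absurd h.2.1 hv
    · exact ⟨.inl h, (Finset.mem_sdiff.1 (hr.left_mem h)).2,
        (Finset.mem_sdiff.1 (hr.right_mem h)).2⟩

/-- Inclusion-exclusion over the sets of sinks of the acyclic orientations. -/
theorem sum_indepSets_card_acyclicOrientations [Fintype α] {adj : α → α → Prop}
    (hadj : ∀ u v, adj u v → adj v u) {W : Finset α} (hW : W.Nonempty) :
    ∑ T ∈ indepSets adj W, (-1 : ℤ) ^ T.card * (acyclicOrientations adj (W \ T)).card = 0 := by
  have hsum (r) (hr : r ∈ acyclicOrientations adj W) :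
      ∑ T ∈ indepSets adj W, (if T ⊆ sinks W r then (-1 : ℤ) ^ T.card else 0) = 0 := by
    have hr := mem_acyclicOrientations.1 hr
    rw [← Finset.sum_filter, ← Finset.sum_powerset_neg_one_pow_card_of_nonempty
      (hr.sinks_nonempty hW)]
    refine Finset.sum_congr (Finset.ext fun T ↦ ?_) fun _ _ ↦ rfl
    rw [Finset.mem_filter, mem_indepSets, Finset.mem_powerset]
    exact ⟨fun h ↦ h.2, fun h ↦
      ⟨⟨h.trans fun v hv ↦ (mem_sinks.1 hv).1, hr.isIndep_of_subset_sinks h⟩, h⟩⟩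
  rw [← Finset.sum_eq_zero hsum, Finset.sum_comm]
  refine Finset.sum_congr rfl fun T hT ↦ ?_
  obtain ⟨hTW, hT⟩ := mem_indepSets.1 hT
  rw [← Finset.sum_filter, Finset.sum_const, card_acyclicOrientations_sinks hadj hTW hT,
    nsmul_eq_mul, mul_comm]

/-- Existence of the chromatic polynomial of an induced subgraph, and its value at `-1`. -/
theorem exists_chromaticPolynomial [Fintype α] {adj : α → α → Prop}
    (hadj : ∀ u v, adj u v → adj v u) (W : Finset α) :
    ∃ χ : Polynomial ℚ, (∀ m : ℕ, χ.eval (m : ℚ) = (inducedColorings adj W m).card) ∧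
      (-1 : ℚ) ^ W.card * χ.eval (-1) = (acyclicOrientations adj W).card := by
  induction W using Finset.strongInduction with
  | H W ih =>
  rcases W.eq_empty_or_nonempty with rfl | hW
  · have hc (m : ℕ) : inducedColorings adj ∅ m = {fun _ ↦ 0} := by
      ext k
      simp [mem_inducedColorings, funext_iff]
    have ha : acyclicOrientations adj ∅ = {fun _ _ ↦ False} := by
      ext r
      rw [mem_acyclicOrientations, Finset.mem_singleton]
      refine ⟨fun h ↦ ?_, ?_⟩
      · funext u v
        exact propext ⟨fun h' ↦ absurd (h.left_mem h') (Finset.notMem_empty u), False.elim⟩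
      · rintro rfl
        refine ⟨False.elim, False.elim, False.elim, fun h ↦ absurd h (Finset.notMem_empty _),
          fun x hx ↦ ?_⟩
        obtain ⟨y, hy, -⟩ := Relation.TransGen.head'_iff.1 hx
        exact hy
    exact ⟨1, by simp [hc], by simp [ha]⟩
  · have hlt (T) (hT : T ∈ (indepSets adj W).erase ∅) : W \ T ⊂ W :=
      have hT := Finset.mem_erase.1 hT
      Finset.sdiff_ssubset (mem_indepSets.1 hT.2).1 (Finset.nonempty_iff_ne_empty.2 hT.1)
    choose! P hP hP' using ih
    obtain ⟨q, hq0, hq⟩ := Polynomial.exists_antidifference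
      (∑ T ∈ (indepSets adj W).erase ∅, P (W \ T))
    simp only [Polynomial.eval_finsetSum] at hq
    refine ⟨q, fun m ↦ ?_, ?_⟩
    · induction m with
      | zero =>
        obtain ⟨v, hv⟩ := hW
        have : inducedColorings adj W 0 = ∅ := by
          refine Finset.eq_empty_of_forall_notMem fun k hk ↦ ?_
          have := (mem_inducedColorings.1 hk).1 v hv
          lia
        simp [this, hq0]
      | succ m ihm =>
        rw [card_inducedColorings_succ, ← Finset.add_sum_erase _ _ (empty_mem_indepSets adj W),
          Finset.sdiff_empty, Nat.cast_add (inducedColorings adj W m).card, ← ihm, Nat.cast_sum,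
          Nat.cast_succ, ← sub_eq_iff_eq_add', hq]
        exact Finset.sum_congr rfl fun T hT ↦ hP _ (hlt T hT) m
    · have hneg := hq (-1)
      rw [neg_add_cancel, hq0, zero_sub] at hneg
      have hsum := sum_indepSets_card_acyclicOrientations hadj hW
      rw [← Finset.add_sum_erase _ _ (empty_mem_indepSets adj W), Finset.sdiff_empty,
        Finset.card_empty, pow_zero, one_mul] at hsum
      rw [neg_eq_iff_eq_neg.1 hneg, mul_neg, Finset.mul_sum, ← Int.cast_natCast,
        eq_neg_of_add_eq_zero_left hsum]
      push_cast
      refine congrArg _ (Finset.sum_congr rfl fun T hT ↦ ?_)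
      have hTW := (mem_indepSets.1 (Finset.mem_erase.1 hT).2).1
      rw [← hP' _ (hlt T hT), ← mul_assoc, ← pow_add,
        ← Finset.card_sdiff_add_card_eq_card hTW, add_comm]

theorem Relation.TransGen.exists_walk {V : Type*} {r : V → V → Prop} {a b : V}
    (h : Relation.TransGen r a b) :
    ∃ n, 0 < n ∧ ∃ w : ℕ → V, w 0 = a ∧ w n = b ∧ ∀ i < n, r (w i) (w (i + 1)) := by
  induction h using Relation.TransGen.head_induction_on with
  | @single a hab =>
    refine ⟨1, one_pos, fun i ↦ if i = 0 then a else b, by simp, by simp, fun i hi ↦ ?_⟩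
    obtain rfl : i = 0 := by lia
    simpa using hab
  | @head a c hac _ ih =>
    obtain ⟨n, -, w, rfl, hn, hw⟩ := ih
    refine ⟨n + 1, n.succ_pos, fun i ↦ i.casesOn a w, rfl, hn, fun i hi ↦ ?_⟩
    cases i with
    | zero => exact hac
    | succ i => exact hw i (by lia)

/-- A shortest closed walk does not repeat vertices. -/
theorem Relation.TransGen.exists_injOn_closed_walk {V : Type*} {r : V → V → Prop} {a : V}
    (h : Relation.TransGen r a a) :
    ∃ n, 0 < n ∧ ∃ w : ℕ → V, w n = w 0 ∧ (∀ i < n, r (w i) (w (i + 1))) ∧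
      Set.InjOn w (Set.Iio n) := by
  classical
  have hex : ∃ n, 0 < n ∧ ∃ w : ℕ → V, w n = w 0 ∧ ∀ i < n, r (w i) (w (i + 1)) := by
    obtain ⟨n, hn, w, h0, hwn, hw⟩ := h.exists_walk
    exact ⟨n, hn, w, hwn.trans h0.symm, hw⟩
  obtain ⟨hn, w, hwn, hw⟩ := Nat.find_spec hex
  have hlt {i j : ℕ} (hij : i < j) (hj : j < Nat.find hex) : w i ≠ w j := fun h ↦
    Nat.find_min hex (m := j - i) (by lia) ⟨by lia, fun t ↦ w (i + t), by
      simp only [add_zero, Nat.add_sub_cancel' hij.le, h], fun t ht ↦ hw _ (by lia)⟩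
  refine ⟨_, hn, w, hwn, hw, fun i hi j hj hij ↦ ?_⟩
  rcases lt_trichotomy i j with h | h | h
  · exact absurd hij (hlt h hj)
  · exact h
  · exact absurd hij.symm (hlt h hi)

/-- The relation on vertices induced by an orientation: `{u, v}` is an edge with head `v`. -/
def orientationRel {H : Finset (Finset α)} (f : Edge H → α) (u v : α) : Prop :=
  ∃ e : Edge H, e.1 = {u, v} ∧ f e = v

theorem ne_of_pair_mem {H : Finset (Finset α)} (h2 : ∀ e ∈ H, e.card = 2) {u v : α}
    (h : {u, v} ∈ H) : u ≠ v := by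
  rintro rfl
  simpa using h2 _ h

theorem pair_eq_of_card_eq_two {e : Finset α} (he : e.card = 2) {u v : α} (hu : u ∈ e)
    (hv : v ∈ e) (huv : u ≠ v) : e = {u, v} := by
  refine (Finset.eq_of_subset_of_card_le ?_ ?_).symm
  · exact Finset.insert_subset hu (Finset.singleton_subset_iff.2 hv)
  · rw [he, Finset.card_pair huv]

theorem HasCycle.exists_transGen {H : Finset (Finset α)} (h2 : ∀ e ∈ H, e.card = 2)
    {f : Edge H → α} (hf : IsOrientation f) (h : HasCycle f) :
    ∃ x, Relation.TransGen (orientationRel f) x x := by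
  obtain ⟨l, hl, -, hcyc⟩ := h
  have hpos : 0 < l.length := List.length_pos_iff.2 hl
  let e (i : ℕ) : Edge H := l.get ⟨i % l.length, Nat.mod_lt _ hpos⟩
  have hstep (i : ℕ) : orientationRel f (f (e i)) (f (e (i + 1))) := by
    have h := hcyc ⟨i % l.length, Nat.mod_lt _ hpos⟩
    simp only [Nat.mod_add_mod] at h
    exact ⟨e (i + 1), pair_eq_of_card_eq_two (h2 _ (e (i + 1)).2.1) h.1 (hf _) h.2, rfl⟩
  have hwalk (i : ℕ) : Relation.TransGen (orientationRel f) (f (e 0)) (f (e (i + 1))) := by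
    induction i with
    | zero => exact .single (hstep 0)
    | succ i ih => exact ih.tail (hstep _)
  have hloop : e (l.length - 1 + 1) = e 0 := by
    simp [e, Nat.sub_add_cancel hpos]
  exact ⟨_, hloop ▸ hwalk (l.length - 1)⟩

theorem hasCycle_of_transGen {H : Finset (Finset α)} (h2 : ∀ e ∈ H, e.card = 2)
    {f : Edge H → α} {x : α} (h : Relation.TransGen (orientationRel f) x x) : HasCycle f := by
  obtain ⟨n, hn, w, hwn, hw, hinj⟩ := h.exists_injOn_closed_walk
  have : Nonempty (Edge H) := ⟨(hw 0 hn).choose⟩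
  choose! e he hfe using hw
  have hmod {i : ℕ} (hi : i < n) : w ((i + 1) % n) = w (i + 1) := by
    rcases (Nat.succ_le_of_lt hi).lt_or_eq with h | h
    · rw [Nat.mod_eq_of_lt h]
    · rw [show i + 1 = n from h, Nat.mod_self, hwn]
  refine ⟨List.ofFn fun i : Fin n ↦ e i, ?_, ?_, fun i ↦ ?_⟩
  · rw [Ne, List.ofFn_eq_nil_iff]
    exact hn.ne'
  · refine List.nodup_ofFn.2 fun i j hij ↦ Fin.ext ?_
    have h : w (i + 1) = w (j + 1) := by rw [← hfe i i.2, ← hfe j j.2, hij]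
    rw [← hmod i.2, ← hmod j.2] at h
    have := hinj (Nat.mod_lt _ hn) (Nat.mod_lt _ hn) h
    exact Nat.ModEq.eq_of_lt_of_lt (Nat.ModEq.add_right_cancel' 1 this) i.2 j.2
  · obtain ⟨i, hi⟩ := i
    rw [List.length_ofFn] at hi
    simp only [List.get_ofFn, List.length_ofFn]
    have hi' := Nat.mod_lt (i + 1) hn
    change f (e i) ∈ (e ((i + 1) % n)).1 ∧ f (e i) ≠ f (e ((i + 1) % n))
    rw [he _ hi', hfe i hi, hfe _ hi', ← hmod hi]
    refine ⟨Finset.mem_insert_self _ _, ne_of_pair_mem h2 ?_⟩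
    rw [← he _ hi']
    exact (e _).2.1

theorem IsOrientation.not_hasCycle_iff {H : Finset (Finset α)} (h2 : ∀ e ∈ H, e.card = 2)
    {f : Edge H → α} (hf : IsOrientation f) :
    ¬ HasCycle f ↔ ∀ x, ¬ Relation.TransGen (orientationRel f) x x := by
  rw [← not_exists]
  exact not_congr ⟨fun h ↦ h.exists_transGen h2 hf, fun ⟨_, h⟩ ↦ hasCycle_of_transGen h2 h⟩

theorem exists_eq_pair_head {H : Finset (Finset α)} (h2 : ∀ e ∈ H, e.card = 2)
    {f : Edge H → α} (hf : IsOrientation f) (e : Edge H) : ∃ u, e.1 = {u, f e} := by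
  obtain ⟨u, hu, hne⟩ := Finset.exists_mem_ne (by rw [h2 _ e.2.1]; exact one_lt_two) (f e)
  exact ⟨u, pair_eq_of_card_eq_two (h2 _ e.2.1) hu (hf e) hne⟩

theorem IsOrientation.isAcyclicOrientation [Fintype α] {H : Finset (Finset α)}
    (h2 : ∀ e ∈ H, e.card = 2) {f : Edge H → α} (hf : IsOrientation f) (hc : ¬ HasCycle f) :
    IsAcyclicOrientation (fun u v ↦ {u, v} ∈ H) Finset.univ (orientationRel f) where
  left_mem _ := Finset.mem_univ _
  right_mem _ := Finset.mem_univ _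
  adj_of := by
    rintro u v ⟨e, he, -⟩
    exact he ▸ e.2.1
  total {u v} _ _ huv := by
    let e : Edge H := ⟨{u, v}, huv, Finset.insert_nonempty _ _⟩
    have h : f e ∈ ({u, v} : Finset α) := hf e
    rw [Finset.mem_insert, Finset.mem_singleton] at h
    rcases h with h | h
    · exact .inr ⟨e, Finset.pair_comm u v, h⟩
    · exact .inl ⟨e, rfl, h⟩
  acyclic := (hf.not_hasCycle_iff h2).1 hc

theorem orientationRel_injOn {H : Finset (Finset α)} (h2 : ∀ e ∈ H, e.card = 2) :
    Set.InjOn (orientationRel (H := H)) {f | IsOrientation f} := by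
  intro f hf g _ hfg
  funext e
  obtain ⟨u, hu⟩ := exists_eq_pair_head h2 hf e
  have h : orientationRel g u (f e) := hfg ▸ ⟨e, hu, rfl⟩
  obtain ⟨e', he', hg⟩ := h
  rw [Subtype.ext (he'.trans hu.symm)] at hg
  exact hg.symm

theorem IsAcyclicOrientation.exists_orientationRel_eq [Fintype α] {H : Finset (Finset α)}
    (h2 : ∀ e ∈ H, e.card = 2) {r : α → α → Prop}
    (hr : IsAcyclicOrientation (fun u v ↦ {u, v} ∈ H) Finset.univ r) :
    ∃ f : Edge H → α, IsOrientation f ∧ orientationRel f = r := by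
  have hex (e : Edge H) : ∃ v u, e.1 = {u, v} ∧ r u v := by
    obtain ⟨u, v, -, he⟩ := Finset.card_eq_two.1 (h2 _ e.2.1)
    rcases hr.total (Finset.mem_univ u) (Finset.mem_univ v) (he ▸ e.2.1) with h | h
    · exact ⟨v, u, he, h⟩
    · exact ⟨u, v, he.trans (Finset.pair_comm u v), h⟩
  choose f t he hrf using hex
  refine ⟨f, fun e ↦ ?_, ?_⟩
  · rw [he e]
    simp
  funext u v
  refine propext ⟨?_, fun h ↦ ?_⟩
  · rintro ⟨e, hev, rfl⟩
    have hu : u ∈ ({t e, f e} : Finset α) := by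
      rw [← he e, hev]
      simp
    rw [Finset.mem_insert, Finset.mem_singleton] at hu
    rw [hu.resolve_right (ne_of_pair_mem h2 (hev ▸ e.2.1))]
    exact hrf e
  · let e : Edge H := ⟨{u, v}, hr.adj_of h, Finset.insert_nonempty _ _⟩
    have huv : ({u, v} : Finset α) = {t e, f e} := he e
    refine ⟨e, rfl, ?_⟩
    have hf : f e ∈ ({u, v} : Finset α) := by simp [huv]
    rw [Finset.mem_insert, Finset.mem_singleton] at hf
    refine hf.resolve_left fun hfu ↦ ?_
    have hv : v ∈ ({t e, f e} : Finset α) := by simp [← huv]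
    rw [Finset.mem_insert, Finset.mem_singleton] at hv
    have hne := ne_of_pair_mem h2 (hr.adj_of h)
    have hvt : v = t e := hv.resolve_right fun hvf ↦ hne (hvf.trans hfu).symm
    have hback := hrf e
    rw [hfu, ← hvt] at hback
    exact hr.acyclic u (.tail (.single h) hback)

theorem card_acyclic_eq_card_acyclicOrientations [Fintype α] {H : Finset (Finset α)}
    (h2 : ∀ e ∈ H, e.card = 2) :
    Nat.card {f : Edge H → α // IsOrientation f ∧ ¬ HasCycle f} =
      (acyclicOrientations (fun u v ↦ {u, v} ∈ H) Finset.univ).card := by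
  rw [← Nat.card_eq_finsetCard]
  refine Nat.card_eq_of_bijective (fun f ↦ ⟨orientationRel f.1,
    mem_acyclicOrientations.2 (f.2.1.isAcyclicOrientation h2 f.2.2)⟩) ⟨fun f g hfg ↦ ?_, ?_⟩
  · exact Subtype.ext (orientationRel_injOn h2 f.2.1 g.2.1 (congrArg Subtype.val hfg))
  · rintro ⟨r, hr⟩
    have hr := mem_acyclicOrientations.1 hr
    obtain ⟨f, hf, rfl⟩ := hr.exists_orientationRel_eq h2
    exact ⟨⟨f, hf, (hf.not_hasCycle_iff h2).2 hr.acyclic⟩, rfl⟩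

theorem proper_iff {H : Finset (Finset α)} (h2 : ∀ e ∈ H, e.card = 2) {m : ℕ} {S : α → Fin m} :
    Proper H S ↔ ∀ u v, {u, v} ∈ H → S u ≠ S v := by
  refine ⟨fun h u v huv ↦ h _ huv u (by simp) v (by simp) (ne_of_pair_mem h2 huv),
    fun h e he u hu v hv huv ↦ h u v ?_⟩
  rwa [← pair_eq_of_card_eq_two (h2 e he) hu hv huv]

theorem card_proper_eq_card_inducedColorings [Fintype α] {H : Finset (Finset α)}
    (h2 : ∀ e ∈ H, e.card = 2) (m : ℕ) :
    Nat.card {S : α → Fin m // Proper H S} =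
      (inducedColorings (fun u v ↦ {u, v} ∈ H) Finset.univ m).card := by
  rw [← Nat.card_eq_finsetCard]
  refine Nat.card_eq_of_bijective (fun S ↦ ⟨fun v ↦ S.1 v + 1, mem_inducedColorings.2
    ⟨fun v _ ↦ ⟨Nat.le_add_left _ _, (S.1 v).2⟩, fun v hv ↦ absurd (Finset.mem_univ v) hv,
      fun u _ v _ huv h ↦ (proper_iff h2).1 S.2 u v huv (Fin.ext (Nat.succ_injective h))⟩⟩)
    ⟨fun S S' h ↦ ?_, ?_⟩
  · refine Subtype.ext (funext fun v ↦ Fin.ext (Nat.succ_injective ?_))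
    exact congrFun (congrArg Subtype.val h) v
  · rintro ⟨k, hk⟩
    obtain ⟨hk, -, hadj⟩ := mem_inducedColorings.1 hk
    have hk (v : α) := hk v (Finset.mem_univ v)
    refine ⟨⟨fun v ↦ ⟨k v - 1, by have := hk v; lia⟩, (proper_iff h2).2 fun u v huv h ↦ ?_⟩, ?_⟩
    · refine hadj u (Finset.mem_univ u) v (Finset.mem_univ v) huv ?_
      have hu := hk u
      have hv := hk v
      have h := Fin.mk.inj_iff.1 h
      lia
    · exact Subtype.ext (funext fun v ↦ Nat.sub_add_cancel (hk v).1)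

/-- For a finite simple graph, compatible pairs (acyclic orientation, coloring with one
color) are exactly the acyclic orientations, and `(-1)^{|I|} χ(-1)` is the number of
acyclic orientations (Stanley's reciprocity at `n = 1`). -/
theorem stmt_12 {α : Type*} [Fintype α] [DecidableEq α] (H : Finset (Finset α))
    (h2 : ∀ e ∈ H, e.card = 2) (χ : Polynomial ℚ)
    (hχ : ∀ m : ℕ, χ.eval (m : ℚ) = Nat.card {S : α → Fin m // Proper H S}) :
    Nat.card {p : (Edge H → α) × (α → Fin 1) //
        IsOrientation p.1 ∧ ¬ HasCycle p.1 ∧ Compat p.1 p.2} =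
      Nat.card {f : Edge H → α // IsOrientation f ∧ ¬ HasCycle f} ∧
    (-1 : ℚ) ^ Fintype.card α * χ.eval (-1) =
      Nat.card {f : Edge H → α // IsOrientation f ∧ ¬ HasCycle f} := by
  refine ⟨Nat.card_congr ⟨fun p ↦ ⟨p.1.1, p.2.1, p.2.2.1⟩,
    fun f ↦ ⟨(f.1, fun _ ↦ 0), f.2.1, f.2.2, fun _ _ _ ↦ le_rfl⟩,
    fun p ↦ Subtype.ext (Prod.ext rfl (Subsingleton.elim _ _)), fun _ ↦ rfl⟩, ?_⟩
  obtain ⟨P, hP, hP'⟩ := exists_chromaticPolynomial (adj := fun u v : α ↦ {u, v} ∈ H)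
    (fun u v h ↦ by rwa [Finset.pair_comm]) Finset.univ
  have hχP : χ = P := by
    refine Polynomial.eq_of_infinite_eval_eq _ _
      ((Set.infinite_range_of_injective (Nat.cast_injective (R := ℚ))).mono ?_)
    rintro _ ⟨m, rfl⟩
    exact (hχ m).trans (by rw [hP, card_proper_eq_card_inducedColorings h2])
  rw [hχP, ← Finset.card_univ, hP', card_acyclic_eq_card_acyclicOrientations h2]
end
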